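/- Chien-Lih's six-term Machin-like formula: π/4 = 183·arctan(1/239) + 32·arctan(1/1023) - 68·arctan(1/5832) + 12·arctan(1/110443) - 12·arctan(1/4841182) - 100·arctan(1/6826318). -/

import Mathlib

/-- `θ` is an argument (mod π) of `a + b i`. -/
def IsArg (θ a b : ℝ) : Prop := ∃ r : ℝ, r ≠ 0 ∧ a = r * Real.cos θ ∧ b = r * Real.sin θ

theorem IsArg.mul {θ a b φ c d : ℝ} (h : IsArg θ a b) (k : IsArg φ c d) :
    IsArg (θ + φ) (a * c - b * d) (a * d + b * c) := by
  obtain ⟨r, hr, rfl, rfl⟩ := h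
  obtain ⟨s, hs, rfl, rfl⟩ := k
  refine ⟨r * s, mul_ne_zero hr hs, ?_, ?_⟩
  · rw [Real.cos_add]; ring
  · rw [Real.sin_add]; ring

theorem isArg_arctan (n : ℝ) (hn : 0 < n) : IsArg (Real.arctan (1 / n)) n 1 := by
  have hc := Real.cos_arctan_pos (1 / n)
  have ht := Real.tan_arctan (1 / n)
  rw [Real.tan_eq_sin_div_cos, div_eq_iff hc.ne'] at ht
  refine ⟨n / Real.cos (Real.arctan (1 / n)), (div_pos hn hc).ne', ?_, ?_⟩
  · field_simp
  · rw [ht]; field_simp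

theorem isArg_neg_arctan (n : ℝ) (hn : 0 < n) : IsArg (-Real.arctan (1 / n)) n (-1) := by
  obtain ⟨r, hr, h1, h2⟩ := isArg_arctan n hn
  refine ⟨r, hr, ?_, ?_⟩
  · rw [Real.cos_neg]; exact h1
  · rw [Real.sin_neg]; linarith

theorem arctan_bounds (n : ℝ) (hn : 0 < n) :
    0 < Real.arctan (1 / n) ∧ Real.arctan (1 / n) < 1 / n := by
  have h : 0 < 1 / n := by positivity
  have hp := Real.arctan_pos.2 h
  have hl := Real.lt_tan hp (Real.arctan_lt_pi_div_two _)
  rw [Real.tan_arctan] at hl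
  exact ⟨hp, hl⟩

theorem isArg_eq {θ a : ℝ} (h : IsArg θ a a) (h1 : -2 < θ) (h2 : θ < 2) : θ = Real.pi / 4 := by
  obtain ⟨r, hr, hc, hs⟩ := h
  have hcs : Real.cos θ = Real.sin θ := mul_left_cancel₀ hr (hc.symm.trans hs)
  have hpi := Real.pi_gt_three
  have hz : Real.sin (θ - Real.pi / 4) = 0 := by
    rw [Real.sin_sub, Real.cos_pi_div_four, Real.sin_pi_div_four, hcs]; ring
  have := (Real.sin_eq_zero_iff_of_lt_of_lt (by linarith) (by linarith)).1 hz
  linarith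

theorem IsArg.finish {θ φ a : ℝ} (h : IsArg φ a a) (e : θ = φ) : ∃ a : ℝ, IsArg θ a a :=
  ⟨a, e ▸ h⟩

theorem combo {t1 t2 t3 t4 t5 t6 : ℝ} (h1 : IsArg t1 239 1) (h2 : IsArg t2 1023 1)
    (h3 : IsArg t3 5832 (-1)) (h4 : IsArg t4 110443 1) (h5 : IsArg t5 4841182 (-1))
    (h6 : IsArg t6 6826318 (-1)) :
    ∃ a : ℝ, IsArg (183 * t1 + 32 * t2 + 68 * t3 + 12 * t4 + 12 * t5 + 100 * t6) a a := by
  have h := h1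
  replace h := h.mul h
  norm_num only at h
  replace h := h.mul h3
  norm_num only at h
  replace h := h.mul h6
  norm_num only at h
  replace h := h.mul h
  norm_num only at h
  replace h := h.mul h1
  norm_num only at h
  replace h := h.mul h2
  norm_num only at h
  replace h := h.mul h6
  norm_num only at h
  replace h := h.mul h
  norm_num only at h
  replace h := h.mul h1
  norm_num only at h
  replace h := h.mul h
  norm_num only at h
  replace h := h.mul h4
  norm_num only at h
  replace h := h.mul h5
  norm_num only at h
  replace h := h.mul h
  norm_num only at h
  replace h := h.mul h1
  norm_num only at h
  replace h := h.mul h3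
  norm_num only at h
  replace h := h.mul h4
  norm_num only at h
  replace h := h.mul h5
  norm_num only at h
  replace h := h.mul h6
  norm_num only at h
  replace h := h.mul h
  norm_num only at h
  replace h := h.mul h1
  norm_num only at h
  replace h := h.mul h
  norm_num only at h
  replace h := h.mul h1
  norm_num only at h
  exact h.finish (by ring)

theorem chien_lih_formula :
    Real.pi / 4 =
      183 * Real.arctan (1 / 239) + 32 * Real.arctan (1 / 1023) -
        68 * Real.arctan (1 / 5832) + 12 * Real.arctan (1 / 110443) -
        12 * Real.arctan (1 / 4841182) - 100 * Real.arctan (1 / 6826318) := by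
  obtain ⟨a, ha⟩ := combo (isArg_arctan 239 (by norm_num)) (isArg_arctan 1023 (by norm_num))
    (isArg_neg_arctan 5832 (by norm_num)) (isArg_arctan 110443 (by norm_num))
    (isArg_neg_arctan 4841182 (by norm_num)) (isArg_neg_arctan 6826318 (by norm_num))
  have b1 := arctan_bounds 239 (by norm_num)
  have b2 := arctan_bounds 1023 (by norm_num)
  have b3 := arctan_bounds 5832 (by norm_num)
  have b4 := arctan_bounds 110443 (by norm_num)
  have b5 := arctan_bounds 4841182 (by norm_num)
  have b6 := arctan_bounds 6826318 (by norm_num)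
  have := isArg_eq ha (by linarith) (by linarith)
  linarith
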